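/- arXiv:1811.09343 — 8 statements merged into one kernel-verified Lean document; each statement's English description precedes it below -/
import Mathlib

section
/- Under the stated hypotheses, the function φ = exp∘z is differentiable on [0,M] with φ′(s) = φ(s)·z′(s), and φ′(s) ≥ 0 for all s ∈ [0,M]. -/
theorem stmt4 (p ε : ℝ) (hp : 1 < p) (hε : ε ∈ Set.Ioo (0 : ℝ) 1)
    (a b c d : ℝ)
    (ha : a = (p - 1) ^ 2) (hb : b = -4 * (p - 1) * ε)
    (hc : c = (4 / p) * (1 + (p - 1) * ε)) (hd : d = (4 / p) * (p - 1) * (1 - ε))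
    (θ z φ : ℝ → ℝ)
    (hθ : ∀ s, θ s = (Real.sqrt (4 * a * c - b ^ 2) / (2 * d)) * s +
        Real.arctan (b / Real.sqrt (4 * a * c - b ^ 2)))
    (hz : ∀ s, z s = -(b / (2 * c)) * s +
        (Real.sqrt (4 * a * c - b ^ 2) / (2 * c)) * ∫ τ in (0 : ℝ)..s, Real.tan (θ τ))
    (hφ : ∀ s, φ s = Real.exp (z s))
    (M : ℝ) (hM : 0 < M)
    (hMlt : M < (2 / Real.sqrt p) * Real.sqrt ((1 - ε) / (1 + p * ε)) *
        (Real.pi / 2 + Real.arctan (ε * Real.sqrt (p / (1 + (p - 1) * ε - p * ε ^ 2))))) :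
    (∀ s ∈ Set.Icc 0 M, DifferentiableAt ℝ z s) ∧
    (∀ s ∈ Set.Icc 0 M, HasDerivAt φ (φ s * deriv z s) s) ∧
    ∀ s ∈ Set.Icc 0 M, 0 ≤ deriv φ s := by
  obtain ⟨hε0, hε1⟩ := hε
  have hp0 : 0 < p := by linarith
  have hp1 : 0 < p - 1 := by linarith
  have h1 : 0 < 1 - ε := by linarith
  have h2 : 0 < 1 + p * ε := by positivity
  obtain ⟨r, hr⟩ : ∃ r, r = Real.sqrt p := ⟨_, rfl⟩
  obtain ⟨u, hu⟩ : ∃ u, u = Real.sqrt (1 - ε) := ⟨_, rfl⟩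
  obtain ⟨v, hv⟩ : ∃ v, v = Real.sqrt (1 + p * ε) := ⟨_, rfl⟩
  have hr0 : 0 < r := by rw [hr]; exact Real.sqrt_pos.2 hp0
  have hu0 : 0 < u := by rw [hu]; exact Real.sqrt_pos.2 h1
  have hv0 : 0 < v := by rw [hv]; exact Real.sqrt_pos.2 h2
  have hr2 : r ^ 2 = p := by rw [hr]; exact Real.sq_sqrt hp0.le
  have hu2 : u ^ 2 = 1 - ε := by rw [hu]; exact Real.sq_sqrt h1.le
  have hv2 : v ^ 2 = 1 + p * ε := by rw [hv]; exact Real.sq_sqrt h2.le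
  have hQ : 1 + (p - 1) * ε - p * ε ^ 2 = (u * v) ^ 2 := by
    rw [mul_pow, hu2, hv2]; ring
  have hS : Real.sqrt (4 * a * c - b ^ 2) = 4 * (p - 1) * u * v / r := by
    have : 4 * a * c - b ^ 2 = (4 * (p - 1) * u * v / r) ^ 2 := by
      have e : (4 * (p - 1) * u * v / r) ^ 2 = 16 * (p - 1) ^ 2 * (u * v) ^ 2 / r ^ 2 := by
        ring
      rw [e, ← hQ, hr2, ha, hb, hc]
      field_simp
      ring
    rw [this, Real.sqrt_sq (by positivity)]
  have e1 : Real.sqrt ((1 - ε) / (1 + p * ε)) = u / v := by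
    rw [Real.sqrt_div h1.le, ← hu, ← hv]
  have e2 : Real.sqrt (p / (1 + (p - 1) * ε - p * ε ^ 2)) = r / (u * v) := by
    rw [hQ, Real.sqrt_div hp0.le, Real.sqrt_sq (by positivity), hr]
  rw [e1, e2, ← hr] at hMlt
  rw [hS] at hz hθ
  have hbS : b / (4 * (p - 1) * u * v / r) = -(ε * (r / (u * v))) := by
    rw [hb]; field_simp
  have hkk : 4 * (p - 1) * u * v / r / (2 * d) = r * v / (2 * u) := by
    rw [hd, ← hu2, ← hr2]
    have : r ^ 2 - 1 ≠ 0 := by rw [hr2]; exact hp1.ne'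
    field_simp
  rw [hbS, hkk, Real.arctan_neg] at hθ
  have hc0 : 0 < c := by rw [hc]; positivity
  have hk0 : 0 < r * v / (2 * u) := by positivity
  have hMk : r * v / (2 * u) * M < Real.pi / 2 + Real.arctan (ε * (r / (u * v))) := by
    have := mul_lt_mul_of_pos_left hMlt hk0
    refine this.trans_eq ?_
    field_simp
  have hlow : ∀ s, 0 ≤ s → -Real.arctan (ε * (r / (u * v))) ≤ θ s := by
    intro s hs
    rw [hθ]
    have := mul_nonneg hk0.le hs
    linarith
  have hhigh : ∀ s, s ≤ M → θ s < Real.pi / 2 := by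
    intro s hs
    rw [hθ]
    have := mul_le_mul_of_nonneg_left hs hk0.le
    linarith
  have hA := Real.arctan_lt_pi_div_two (ε * (r / (u * v)))
  have hθc : Continuous θ := by
    rw [funext hθ]; fun_prop
  have hUo : IsOpen (θ ⁻¹' Set.Ioo (-(Real.pi / 2)) (Real.pi / 2)) := isOpen_Ioo.preimage hθc
  have hmem : ∀ s ∈ Set.Icc 0 M, s ∈ θ ⁻¹' Set.Ioo (-(Real.pi / 2)) (Real.pi / 2) := by
    intro s hs
    have := hlow s hs.1
    exact ⟨by linarith, hhigh s hs.2⟩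
  have hcont : ContinuousOn (fun τ => Real.tan (θ τ))
      (θ ⁻¹' Set.Ioo (-(Real.pi / 2)) (Real.pi / 2)) :=
    Real.continuousOn_tan_Ioo.comp hθc.continuousOn (fun x hx => hx)
  have hzd : ∀ s ∈ Set.Icc 0 M, HasDerivAt z
      (-(b / (2 * c)) + 4 * (p - 1) * u * v / r / (2 * c) * Real.tan (θ s)) s := by
    intro s hs
    have hI : HasDerivAt (fun s => ∫ τ in (0 : ℝ)..s, Real.tan (θ τ)) (Real.tan (θ s)) s := by
      apply intervalIntegral.integral_hasDerivAt_right
      · apply ContinuousOn.intervalIntegrable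
        apply hcont.mono
        intro x hx
        rw [Set.uIcc_of_le hs.1] at hx
        exact hmem x ⟨hx.1, hx.2.trans hs.2⟩
      · exact hcont.stronglyMeasurableAtFilter hUo s (hmem s hs)
      · exact hcont.continuousAt (hUo.mem_nhds (hmem s hs))
    rw [funext hz]
    have := ((hasDerivAt_id s).const_mul (-(b / (2 * c)))).add
      (hI.const_mul (4 * (p - 1) * u * v / r / (2 * c)))
    rw [mul_one] at this
    exact this
  have hφd : ∀ s ∈ Set.Icc 0 M, HasDerivAt φ (φ s * deriv z s) s := by
    intro s hs
    rw [(hzd s hs).deriv, hφ s, funext hφ]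
    exact (hzd s hs).exp
  refine ⟨fun s hs => (hzd s hs).differentiableAt, hφd, ?_⟩
  intro s hs
  rw [(hφd s hs).deriv, (hzd s hs).deriv, hφ]
  refine mul_nonneg (Real.exp_pos _).le ?_
  have ht : -(ε * (r / (u * v))) ≤ Real.tan (θ s) := by
    rw [← Real.tan_arctan (-(ε * (r / (u * v)))), Real.arctan_neg]
    have hm := hmem s hs
    have h0 := hmem 0 ⟨le_rfl, hM.le⟩
    apply Real.strictMonoOn_tan.monotoneOn _ hm (hlow s hs.1)
    rw [Set.mem_preimage, hθ, mul_zero, zero_add] at h0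
    exact h0
  rw [← hbS] at ht
  have hS0 : 0 < 4 * (p - 1) * u * v / r := by positivity
  rw [div_le_iff₀ hS0] at ht
  have : -(b / (2 * c)) + 4 * (p - 1) * u * v / r / (2 * c) * Real.tan (θ s)
      = (Real.tan (θ s) * (4 * (p - 1) * u * v / r) - b) / (2 * c) := by ring
  rw [this]
  exact div_nonneg (by linarith) (by linarith)
end

section
/- Under the stated hypotheses, 1 ≤ φ(s) ≤ φ(M) for all s ∈ [0,M]. -/
theorem stmt5 (p ε : ℝ) (hp : 1 < p) (hε : ε ∈ Set.Ioo (0 : ℝ) 1)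
    (a b c d : ℝ)
    (ha : a = (p - 1) ^ 2) (hb : b = -4 * (p - 1) * ε)
    (hc : c = (4 / p) * (1 + (p - 1) * ε)) (hd : d = (4 / p) * (p - 1) * (1 - ε))
    (θ z φ : ℝ → ℝ)
    (hθ : ∀ s, θ s = (Real.sqrt (4 * a * c - b ^ 2) / (2 * d)) * s +
        Real.arctan (b / Real.sqrt (4 * a * c - b ^ 2)))
    (hz : ∀ s, z s = -(b / (2 * c)) * s +
        (Real.sqrt (4 * a * c - b ^ 2) / (2 * c)) * ∫ τ in (0 : ℝ)..s, Real.tan (θ τ))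
    (hφ : ∀ s, φ s = Real.exp (z s))
    (M : ℝ) (hM : 0 < M)
    (hMlt : M < (2 / Real.sqrt p) * Real.sqrt ((1 - ε) / (1 + p * ε)) *
        (Real.pi / 2 + Real.arctan (ε * Real.sqrt (p / (1 + (p - 1) * ε - p * ε ^ 2))))) :
    ∀ s ∈ Set.Icc 0 M, 1 ≤ φ s ∧ φ s ≤ φ M := by
  obtain ⟨hε0, hε1⟩ := hε
  have hp0 : 0 < p := by linarith
  have hp1 : 0 < p - 1 := by linarith
  have he1 : 0 < 1 - ε := by linarith
  have hpe : 0 < 1 + p * ε := by positivity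
  have hcpos : 0 < c := by rw [hc]; positivity
  have hdpos : 0 < d := by rw [hd]; positivity
  obtain ⟨q, hq⟩ : ∃ q, q = Real.sqrt p := ⟨_, rfl⟩
  obtain ⟨u, hu⟩ : ∃ u, u = Real.sqrt (1 - ε) := ⟨_, rfl⟩
  obtain ⟨v, hv⟩ : ∃ v, v = Real.sqrt (1 + p * ε) := ⟨_, rfl⟩
  have hq0 : 0 < q := by rw [hq]; positivity
  have hu0 : 0 < u := by rw [hu]; positivity
  have hv0 : 0 < v := by rw [hv]; positivity
  have hq2 : q ^ 2 = p := by rw [hq]; exact Real.sq_sqrt hp0.le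
  have hu2 : u ^ 2 = 1 - ε := by rw [hu]; exact Real.sq_sqrt he1.le
  have hv2 : v ^ 2 = 1 + p * ε := by rw [hv]; exact Real.sq_sqrt hpe.le
  have hS : Real.sqrt (4 * a * c - b ^ 2) = 4 * (p - 1) * u * v / q := by
    rw [Real.sqrt_eq_iff_mul_self_eq_of_pos (by positivity)]
    rw [← sq, div_pow, mul_pow, mul_pow, hu2, hv2, hq2, ha, hb, hc]
    field_simp
    ring
  have h1 : Real.sqrt ((1 - ε) / (1 + p * ε)) = u / v := by
    rw [Real.sqrt_div he1.le, hu, hv]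
  have h2 : Real.sqrt (p / (1 + (p - 1) * ε - p * ε ^ 2)) = q / (u * v) := by
    rw [show 1 + (p - 1) * ε - p * ε ^ 2 = (1 - ε) * (1 + p * ε) by ring,
      Real.sqrt_div hp0.le, Real.sqrt_mul he1.le, hu, hv, hq]
  rw [h1, h2, ← hq] at hMlt
  rw [hS] at hθ hz
  obtain ⟨S, hSdef⟩ : ∃ S, S = 4 * (p - 1) * u * v / q := ⟨_, rfl⟩
  have hS0 : 0 < S := by rw [hSdef]; positivity
  have hbS : b / S = -(ε * (q / (u * v))) := by
    rw [hSdef, hb]; field_simp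
  have hK : S / (2 * d) * ((2 / q) * (u / v)) = 1 := by
    rw [hSdef, hd, ← hu2, ← hq2]
    have : q ^ 2 - 1 ≠ 0 := by rw [hq2]; exact hp1.ne'
    field_simp
    try norm_num
  rw [← hSdef] at hθ hz
  have hK0 : 0 < S / (2 * d) := by positivity
  have hθM : θ M < Real.pi / 2 := by
    rw [hθ, hbS, Real.arctan_neg]
    have := mul_lt_mul_of_pos_left hMlt hK0
    rw [← mul_assoc, hK, one_mul] at this
    linarith
  have hmono : Monotone θ := by
    intro x y hxy
    rw [hθ, hθ]
    have := mul_le_mul_of_nonneg_left hxy hK0.le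
    linarith
  have hθ0 : θ 0 = Real.arctan (b / S) := by rw [hθ]; ring
  have hlow : -(Real.pi / 2) < θ 0 := by rw [hθ0]; exact Real.neg_pi_div_two_lt_arctan _
  have hmem : ∀ x ∈ Set.Icc 0 M, θ x ∈ Set.Ioo (-(Real.pi / 2)) (Real.pi / 2) := fun x hx =>
    ⟨lt_of_lt_of_le hlow (hmono hx.1), lt_of_le_of_lt (hmono hx.2) hθM⟩
  have hcont : ContinuousOn (fun x => Real.tan (θ x)) (Set.Icc 0 M) := by
    refine Real.continuousOn_tan_Ioo.comp ?_ hmem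
    rw [show θ = _ from funext hθ]
    fun_prop
  have htan : ∀ x ∈ Set.Icc 0 M, b / S ≤ Real.tan (θ x) := by
    intro x hx
    rw [← Real.tan_arctan (b / S), ← hθ0]
    exact Real.strictMonoOn_tan.monotoneOn (hmem 0 ⟨le_rfl, hM.le⟩) (hmem x hx) (hmono hx.1)
  have hint : ∀ x y, 0 ≤ x → x ≤ y → y ≤ M →
      IntervalIntegrable (fun x => Real.tan (θ x)) MeasureTheory.volume x y := by
    intro x y hx hxy hy
    apply ContinuousOn.intervalIntegrable_of_Icc hxy
    exact hcont.mono (Set.Icc_subset_Icc hx hy)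
  have key : ∀ x y, 0 ≤ x → x ≤ y → y ≤ M → z x ≤ z y := by
    intro x y hx hxy hy
    have hadd := intervalIntegral.integral_add_adjacent_intervals
      (hint 0 x le_rfl hx (hxy.trans hy)) (hint x y hx hxy hy)
    have hge : ∫ τ in x..y, (b / S) ≤ ∫ τ in x..y, Real.tan (θ τ) :=
      intervalIntegral.integral_mono_on hxy intervalIntegrable_const (hint x y hx hxy hy)
        (fun t ht => htan t ⟨hx.trans ht.1, ht.2.trans hy⟩)
    rw [intervalIntegral.integral_const, smul_eq_mul] at hge
    have h3 := mul_le_mul_of_nonneg_left hge (show 0 ≤ S / (2 * c) by positivity)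
    have h4 : S / (2 * c) * ((y - x) * (b / S)) = b / (2 * c) * (y - x) := by
      field_simp
    rw [hz, hz, ← hadd, mul_add]
    linarith
  have hz0 : z 0 = 0 := by rw [hz]; simp
  intro s hs
  rw [hφ, hφ]
  refine ⟨Real.one_le_exp ?_, Real.exp_le_exp.2 (key s M hs.1 hs.2 le_rfl)⟩
  rw [← hz0]
  exact key 0 s le_rfl hs.1 hs.2
end

section
/- Under the stated hypotheses, the function z is twice differentiable on [0,M] and its second derivative satisfies z″(s) = (1/d)·(a + b·z′(s) + c·(z′(s))²) for all s ∈ [0,M]. -/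
theorem stmt6 (p ε : ℝ) (hp : 1 < p) (hε : ε ∈ Set.Ioo (0 : ℝ) 1)
    (a b c d : ℝ)
    (ha : a = (p - 1) ^ 2) (hb : b = -4 * (p - 1) * ε)
    (hc : c = (4 / p) * (1 + (p - 1) * ε)) (hd : d = (4 / p) * (p - 1) * (1 - ε))
    (θ z φ : ℝ → ℝ)
    (hθ : ∀ s, θ s = (Real.sqrt (4 * a * c - b ^ 2) / (2 * d)) * s +
        Real.arctan (b / Real.sqrt (4 * a * c - b ^ 2)))
    (hz : ∀ s, z s = -(b / (2 * c)) * s +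
        (Real.sqrt (4 * a * c - b ^ 2) / (2 * c)) * ∫ τ in (0 : ℝ)..s, Real.tan (θ τ))
    (hφ : ∀ s, φ s = Real.exp (z s))
    (M : ℝ) (hM : 0 < M)
    (hMlt : M < (2 / Real.sqrt p) * Real.sqrt ((1 - ε) / (1 + p * ε)) *
        (Real.pi / 2 + Real.arctan (ε * Real.sqrt (p / (1 + (p - 1) * ε - p * ε ^ 2))))) :
    (∀ s ∈ Set.Icc 0 M, DifferentiableAt ℝ z s) ∧
    (∀ s ∈ Set.Icc 0 M, DifferentiableAt ℝ (deriv z) s) ∧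
    ∀ s ∈ Set.Icc 0 M,
      deriv (deriv z) s = (1 / d) * (a + b * deriv z s + c * (deriv z s) ^ 2) := by
  obtain ⟨hε0, hε1⟩ := hε
  have hp0 : 0 < p := by linarith
  have hp1 : 0 < p - 1 := by linarith
  have he1 : 0 < 1 - ε := by linarith
  have hpe : 0 < 1 + p * ε := by positivity
  have hQ : 1 + (p - 1) * ε - p * ε ^ 2 = (1 - ε) * (1 + p * ε) := by ring
  have hc0 : 0 < c := by rw [hc]; positivity
  have hd0 : 0 < d := by rw [hd]; positivity
  have hDD : 4 * a * c - b ^ 2 = 16 * (p - 1) ^ 2 * ((1 - ε) * (1 + p * ε)) / p := by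
    rw [ha, hb, hc]; field_simp; ring
  have hDpos : 0 < 4 * a * c - b ^ 2 := by rw [hDD]; positivity
  have hD2 : Real.sqrt (4 * a * c - b ^ 2) ^ 2 = 4 * a * c - b ^ 2 := Real.sq_sqrt hDpos.le
  have hD0 : 0 < Real.sqrt (4 * a * c - b ^ 2) := Real.sqrt_pos.2 hDpos
  generalize Real.sqrt (4 * a * c - b ^ 2) = D at *
  rw [hQ] at hMlt
  have hK : D * ((2 / Real.sqrt p) * Real.sqrt ((1 - ε) / (1 + p * ε))) = 2 * d := by
    rw [← sq_eq_sq₀ (by positivity) (by positivity), mul_pow, mul_pow, div_pow,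
      Real.sq_sqrt hp0.le, Real.sq_sqrt (by positivity), hD2, hDD, hd]
    field_simp
    ring
  have hB : b / D = -(ε * Real.sqrt (p / ((1 - ε) * (1 + p * ε)))) := by
    have h1 : D * (ε * Real.sqrt (p / ((1 - ε) * (1 + p * ε)))) = -b := by
      have hb0 : 0 ≤ -b := by
        have : 0 ≤ 4 * (p - 1) * ε := by positivity
        rw [hb]; linarith
      rw [← sq_eq_sq₀ (by positivity) hb0, mul_pow, mul_pow,
        Real.sq_sqrt (by positivity), hD2, hDD, hb]
      field_simp
      ring
    rw [div_eq_iff hD0.ne']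
    linarith
  have hA : Real.arctan (b / D) =
      -Real.arctan (ε * Real.sqrt (p / ((1 - ε) * (1 + p * ε)))) := by
    rw [hB, Real.arctan_neg]
  have hlow := Real.neg_pi_div_two_lt_arctan (b / D)
  have hhigh := Real.arctan_lt_pi_div_two (b / D)
  have hk : 0 < D / (2 * d) := by positivity
  have hθM : D / (2 * d) * M + Real.arctan (b / D) < Real.pi / 2 := by
    have h2 := mul_lt_mul_of_pos_left hMlt hk
    have h3 : D / (2 * d) * ((2 / Real.sqrt p) * Real.sqrt ((1 - ε) / (1 + p * ε))) = 1 := by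
      rw [div_mul_eq_mul_div, hK]; field_simp
    rw [← mul_assoc, h3] at h2
    linarith
  have hθd : ∀ x, HasDerivAt θ (D / (2 * d)) x := by
    intro x
    have h : HasDerivAt (fun s => D / (2 * d) * s + Real.arctan (b / D)) (D / (2 * d) * 1) x :=
      ((hasDerivAt_id x).const_mul _).add_const _
    rw [mul_one] at h
    rwa [show θ = _ from funext hθ]
  have hθc : Continuous θ := continuous_iff_continuousAt.2 fun x => (hθd x).continuousAt
  have hθm : Monotone θ := by
    intro x y hxy
    rw [hθ, hθ]
    have := mul_le_mul_of_nonneg_left hxy hk.le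
    linarith
  set U : Set ℝ := {x | θ x ∈ Set.Ioo (-(Real.pi / 2)) (Real.pi / 2)} with hU
  have hUo : IsOpen U := isOpen_Ioo.preimage hθc
  have h0U : (0 : ℝ) ∈ U := by
    simp only [hU, Set.mem_setOf_eq, hθ, mul_zero, zero_add]
    exact ⟨hlow, hhigh⟩
  have hUord : ∀ x ∈ U, ∀ y ∈ U, ∀ w ∈ Set.Icc x y, w ∈ U := fun x hx y hy w hw =>
    ⟨hx.1.trans_le (hθm hw.1), (hθm hw.2).trans_lt hy.2⟩
  have hcos : ∀ x ∈ U, Real.cos (θ x) ≠ 0 := fun x hx => (Real.cos_pos_of_mem_Ioo hx).ne'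
  have hsub : Set.Icc 0 M ⊆ U := by
    intro s hs
    refine hUord 0 h0U M ⟨h0U.1.trans_le (hθm hM.le), ?_⟩ s hs
    rw [hθ]; exact hθM
  have htd : ∀ x ∈ U, HasDerivAt (fun s => Real.tan (θ s))
      (1 / Real.cos (θ x) ^ 2 * (D / (2 * d))) x := fun x hx =>
    (Real.hasDerivAt_tan (hcos x hx)).comp x (hθd x)
  have htc : ContinuousOn (fun s => Real.tan (θ s)) U := fun x hx =>
    (htd x hx).continuousAt.continuousWithinAt
  have hzd : ∀ x ∈ U, HasDerivAt z (-(b / (2 * c)) + D / (2 * c) * Real.tan (θ x)) x := by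
    intro x hx
    have hint : IntervalIntegrable (fun s => Real.tan (θ s)) MeasureTheory.volume 0 x := by
      apply ContinuousOn.intervalIntegrable
      apply htc.mono
      intro w hw
      rcases le_total 0 x with h | h
      · rw [Set.uIcc_of_le h] at hw; exact hUord 0 h0U x hx w hw
      · rw [Set.uIcc_of_ge h] at hw; exact hUord x hx 0 h0U w hw
    have hI := intervalIntegral.integral_hasDerivAt_right hint
      (htc.stronglyMeasurableAtFilter hUo x hx) (htd x hx).continuousAt
    have h := ((hasDerivAt_id x).const_mul (-(b / (2 * c)))).add (hI.const_mul (D / (2 * c)))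
    rw [mul_one] at h
    rw [show z = _ from funext hz]
    exact h
  have hz2 : ∀ x ∈ U, HasDerivAt (deriv z)
      (D / (2 * c) * (1 / Real.cos (θ x) ^ 2 * (D / (2 * d)))) x := by
    intro x hx
    refine HasDerivAt.congr_of_eventuallyEq
      (((htd x hx).const_mul (D / (2 * c))).const_add (-(b / (2 * c)))) ?_
    filter_upwards [hUo.mem_nhds hx] with y hy
    exact (hzd y hy).deriv
  refine ⟨fun s hs => (hzd s (hsub hs)).differentiableAt,
    fun s hs => (hz2 s (hsub hs)).differentiableAt, fun s hs => ?_⟩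
  rw [(hz2 s (hsub hs)).deriv, (hzd s (hsub hs)).deriv]
  have hsec : 1 / Real.cos (θ s) ^ 2 = 1 + Real.tan (θ s) ^ 2 := by
    rw [one_div, ← Real.inv_one_add_tan_sq (hcos s (hsub hs)), inv_inv]
  rw [hsec]
  generalize Real.tan (θ s) = T
  have hab : a = (D ^ 2 + b ^ 2) / (4 * c) := by
    rw [hD2]; field_simp; ring
  clear hU ha
  rw [hab]
  field_simp
  ring
end

section
/- Under the stated hypotheses, the function φ is twice differentiable on [0,M] and for all s ∈ [0,M] one has the identity (1/p)·φ″(s) − φ′(s) = (1/(4(p−1)(1−ε)))·(1/φ(s))·((p−1)·φ(s) − 2·φ′(s))²; in particular (1/p)·φ″(s) − φ′(s) ≥ 0 on [0,M]. -/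
theorem stmt8 (p ε : ℝ) (hp : 1 < p) (hε : ε ∈ Set.Ioo (0 : ℝ) 1)
    (a b c d : ℝ)
    (ha : a = (p - 1) ^ 2) (hb : b = -4 * (p - 1) * ε)
    (hc : c = (4 / p) * (1 + (p - 1) * ε)) (hd : d = (4 / p) * (p - 1) * (1 - ε))
    (θ z φ : ℝ → ℝ)
    (hθ : ∀ s, θ s = (Real.sqrt (4 * a * c - b ^ 2) / (2 * d)) * s +
        Real.arctan (b / Real.sqrt (4 * a * c - b ^ 2)))
    (hz : ∀ s, z s = -(b / (2 * c)) * s +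
        (Real.sqrt (4 * a * c - b ^ 2) / (2 * c)) * ∫ τ in (0 : ℝ)..s, Real.tan (θ τ))
    (hφ : ∀ s, φ s = Real.exp (z s))
    (M : ℝ) (hM : 0 < M)
    (hMlt : M < (2 / Real.sqrt p) * Real.sqrt ((1 - ε) / (1 + p * ε)) *
        (Real.pi / 2 + Real.arctan (ε * Real.sqrt (p / (1 + (p - 1) * ε - p * ε ^ 2))))) :
    (∀ s ∈ Set.Icc 0 M, DifferentiableAt ℝ φ s) ∧
    (∀ s ∈ Set.Icc 0 M, DifferentiableAt ℝ (deriv φ) s) ∧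
    ∀ s ∈ Set.Icc 0 M,
      (1 / p) * deriv (deriv φ) s - deriv φ s =
        (1 / (4 * (p - 1) * (1 - ε))) * (1 / φ s) * ((p - 1) * φ s - 2 * deriv φ s) ^ 2 ∧
      0 ≤ (1 / p) * deriv (deriv φ) s - deriv φ s := by
  obtain ⟨he0, he1⟩ := hε
  have hp0 : 0 < p := by linarith
  have hp1 : 0 < p - 1 := by linarith
  have h1e : 0 < 1 - ε := by linarith
  have hpe : 0 < 1 + p * ε := by positivity
  have hD : 4 * a * c - b ^ 2 = 16 * (p - 1) ^ 2 / p * ((1 - ε) * (1 + p * ε)) := by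
    rw [ha, hb, hc]; field_simp; ring
  have hDpos : 0 < 4 * a * c - b ^ 2 := by rw [hD]; positivity
  have hc0 : 0 < c := by rw [hc]; positivity
  have hd0 : 0 < d := by rw [hd]; positivity
  have hsq := Real.sq_sqrt hDpos.le
  have hS0 : 0 < Real.sqrt (4 * a * c - b ^ 2) := Real.sqrt_pos.mpr hDpos
  have hSval : Real.sqrt (4 * a * c - b ^ 2)
      = 4 * (p - 1) / Real.sqrt p * (Real.sqrt (1 - ε) * Real.sqrt (1 + p * ε)) := by
    rw [Real.sqrt_eq_iff_mul_self_eq hDpos.le (by positivity), hD]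
    have e1 := Real.mul_self_sqrt hp0.le
    have e2 := Real.mul_self_sqrt h1e.le
    have e3 := Real.mul_self_sqrt hpe.le
    symm
    calc _ = 16 * (p - 1) ^ 2 / (Real.sqrt p * Real.sqrt p) *
          ((Real.sqrt (1 - ε) * Real.sqrt (1 - ε)) *
            (Real.sqrt (1 + p * ε) * Real.sqrt (1 + p * ε))) := by
            ring
      _ = _ := by rw [e1, e2, e3]
  have sp0 : 0 < Real.sqrt p := Real.sqrt_pos.mpr hp0
  have se0 : 0 < Real.sqrt (1 - ε) := Real.sqrt_pos.mpr h1e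
  have spe0 : 0 < Real.sqrt (1 + p * ε) := Real.sqrt_pos.mpr hpe
  have harc : b / Real.sqrt (4 * a * c - b ^ 2)
      = -(ε * Real.sqrt (p / (1 + (p - 1) * ε - p * ε ^ 2))) := by
    rw [show 1 + (p - 1) * ε - p * ε ^ 2 = (1 - ε) * (1 + p * ε) by ring,
      Real.sqrt_div hp0.le, Real.sqrt_mul h1e.le, hSval, hb]
    field_simp
  have hk : (2 / Real.sqrt p) * Real.sqrt ((1 - ε) / (1 + p * ε))
      = (Real.sqrt (4 * a * c - b ^ 2) / (2 * d))⁻¹ := by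
    rw [hSval, Real.sqrt_div h1e.le, hd]
    have e1 := Real.sq_sqrt hp0.le
    have e2 := Real.sq_sqrt h1e.le
    field_simp
    rw [e1, e2]
    ring
  rw [hk] at hMlt
  rw [harc] at hθ
  rw [Real.arctan_neg] at hθ
  have hA0 := Real.neg_pi_div_two_lt_arctan (ε * Real.sqrt (p / (1 + (p - 1) * ε - p * ε ^ 2)))
  have hA1 := Real.arctan_lt_pi_div_two (ε * Real.sqrt (p / (1 + (p - 1) * ε - p * ε ^ 2)))
  generalize Real.arctan (ε * Real.sqrt (p / (1 + (p - 1) * ε - p * ε ^ 2))) = A at *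
  generalize Real.sqrt (4 * a * c - b ^ 2) = S at *
  obtain ⟨k, hkdef⟩ : ∃ k, k = S / (2 * d) := ⟨_, rfl⟩
  rw [← hkdef] at hθ hMlt
  have hk0 : 0 < k := by rw [hkdef]; positivity
  have hkM : k * M < Real.pi / 2 + A := by
    rw [inv_mul_eq_div, lt_div_iff₀ hk0] at hMlt
    linarith
  have hθ' : ∀ s, HasDerivAt θ k s := by
    intro s
    rw [show θ = fun s => k * s + -A from funext hθ]
    simpa using ((hasDerivAt_id s).const_mul k).add_const (-A)
  have hθc : Continuous θ := by
    rw [show θ = fun s => k * s + -A from funext hθ]; fun_prop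
  let U : Set ℝ := θ ⁻¹' Set.Ioo (-(Real.pi / 2)) (Real.pi / 2)
  have hUo : IsOpen U := isOpen_Ioo.preimage hθc
  have hU : ∀ s ∈ Set.Icc 0 M, s ∈ U := by
    intro s hs
    have h1 := mul_nonneg hk0.le hs.1
    have h2 := mul_le_mul_of_nonneg_left hs.2 hk0.le
    constructor <;> rw [hθ] <;> linarith
  have hUseg : ∀ s ∈ U, Set.uIcc 0 s ⊆ U := by
    intro s hs t ht
    have h0 := hU 0 ⟨le_rfl, hM.le⟩
    have hoc : U.OrdConnected := by
      refine Set.OrdConnected.preimage_mono Set.ordConnected_Ioo ?_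
      intro x y hxy
      rw [hθ, hθ]
      have := mul_le_mul_of_nonneg_left hxy hk0.le
      linarith
    exact hoc.uIcc_subset h0 hs ht
  have hcos : ∀ s ∈ U, Real.cos (θ s) ≠ 0 := fun s hs => (Real.cos_pos_of_mem_Ioo hs).ne'
  have htan : ∀ s ∈ U, HasDerivAt (fun s => Real.tan (θ s)) (k * (1 + Real.tan (θ s) ^ 2)) s := by
    intro s hs
    have := (Real.hasDerivAt_tan (hcos s hs)).comp s (hθ' s)
    refine this.congr_deriv ?_
    rw [Real.tan_eq_sin_div_cos]
    have h := hcos s hs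
    have := Real.sin_sq_add_cos_sq (θ s)
    field_simp
    linarith
  have htc : ContinuousOn (fun s => Real.tan (θ s)) U :=
    fun s hs => (htan s hs).continuousAt.continuousWithinAt
  obtain ⟨y, hy⟩ : ∃ y : ℝ → ℝ, y = fun s => -(b / (2 * c)) + S / (2 * c) * Real.tan (θ s) :=
    ⟨_, rfl⟩
  have hz' : ∀ s ∈ U, HasDerivAt z (y s) s := by
    intro s hs
    rw [show z = _ from funext hz, hy]
    have hI := intervalIntegral.integral_hasDerivAt_right
      (htc.mono (hUseg s hs)).intervalIntegrable
      (htc.stronglyMeasurableAtFilter hUo s hs) (htan s hs).continuousAt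
    have h3 := ((hasDerivAt_id s).const_mul (-(b / (2 * c)))).add (hI.const_mul (S / (2 * c)))
    exact h3.congr_deriv (by rw [mul_one])
  have hy' : ∀ s ∈ U, HasDerivAt y (S / (2 * c) * (k * (1 + Real.tan (θ s) ^ 2))) s := by
    intro s hs
    rw [hy]
    exact ((htan s hs).const_mul _).const_add _
  have hφ' : ∀ s ∈ U, HasDerivAt φ (φ s * y s) s := by
    intro s hs
    have := (hz' s hs).exp
    rw [← hφ] at this
    rwa [show φ = fun s => Real.exp (z s) from funext hφ] at *
  have hφ'' : ∀ s ∈ U, HasDerivAt (deriv φ)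
      (φ s * y s * y s + φ s * (S / (2 * c) * (k * (1 + Real.tan (θ s) ^ 2)))) s := by
    intro s hs
    refine ((hφ' s hs).mul (hy' s hs)).congr_of_eventuallyEq ?_
    filter_upwards [hUo.mem_nhds hs] with t ht
    exact (hφ' t ht).deriv
  have hric : ∀ s, d * (S / (2 * c) * (k * (1 + Real.tan (θ s) ^ 2)))
      = c * y s ^ 2 + b * y s + a := by
    intro s
    rw [hkdef, hy]
    beta_reduce
    generalize Real.tan (θ s) = t
    have : d * (S / (2 * c) * (S / (2 * d) * (1 + t ^ 2))) = S ^ 2 * (1 + t ^ 2) / (4 * c) := by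
      field_simp; ring
    rw [this]
    have h2 : c * (-(b / (2 * c)) + S / (2 * c) * t) ^ 2
        + b * (-(b / (2 * c)) + S / (2 * c) * t) + a
        = (S ^ 2 * t ^ 2 + (4 * a * c - b ^ 2)) / (4 * c) := by
      field_simp; ring
    rw [h2, ← hsq]; ring
  have key : ∀ s ∈ Set.Icc 0 M, (1 / p) * deriv (deriv φ) s - deriv φ s =
        (1 / (4 * (p - 1) * (1 - ε))) * (1 / φ s) * ((p - 1) * φ s - 2 * deriv φ s) ^ 2 := by
    intro s hs
    have hs := hU s hs
    have hφ0 : φ s ≠ 0 := by rw [hφ]; exact (Real.exp_pos _).ne'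
    rw [(hφ'' s hs).deriv, (hφ' s hs).deriv]
    have h := hric s
    generalize S / (2 * c) * (k * (1 + Real.tan (θ s) ^ 2)) = w at *
    have hw : w = (c * y s ^ 2 + b * y s + a) / d := by
      rw [← h]; field_simp
    rw [hw, ha, hb, hc, hd]
    field_simp
    ring
  refine ⟨fun s hs => (hφ' s (hU s hs)).differentiableAt,
    fun s hs => (hφ'' s (hU s hs)).differentiableAt, fun s hs => ⟨key s hs, ?_⟩⟩
  rw [key s hs]
  have hφ0 : 0 < φ s := by rw [hφ]; exact Real.exp_pos _
  positivity
end

section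
/- Under the stated hypotheses, for all s ∈ [0,M] one has |(p−1)·φ(s) − 2·φ′(s)| − 2·√((p−1)(1−ε)·φ(s)·((1/p)·φ″(s) − φ′(s))) = 0. -/
theorem stmt9 (p ε : ℝ) (hp : 1 < p) (hε : ε ∈ Set.Ioo (0 : ℝ) 1)
    (a b c d : ℝ)
    (ha : a = (p - 1) ^ 2) (hb : b = -4 * (p - 1) * ε)
    (hc : c = (4 / p) * (1 + (p - 1) * ε)) (hd : d = (4 / p) * (p - 1) * (1 - ε))
    (θ z φ : ℝ → ℝ)
    (hθ : ∀ s, θ s = (Real.sqrt (4 * a * c - b ^ 2) / (2 * d)) * s +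
        Real.arctan (b / Real.sqrt (4 * a * c - b ^ 2)))
    (hz : ∀ s, z s = -(b / (2 * c)) * s +
        (Real.sqrt (4 * a * c - b ^ 2) / (2 * c)) * ∫ τ in (0 : ℝ)..s, Real.tan (θ τ))
    (hφ : ∀ s, φ s = Real.exp (z s))
    (M : ℝ) (hM : 0 < M)
    (hMlt : M < (2 / Real.sqrt p) * Real.sqrt ((1 - ε) / (1 + p * ε)) *
        (Real.pi / 2 + Real.arctan (ε * Real.sqrt (p / (1 + (p - 1) * ε - p * ε ^ 2))))) :
    ∀ s ∈ Set.Icc 0 M,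
      |(p - 1) * φ s - 2 * deriv φ s| -
        2 * Real.sqrt ((p - 1) * (1 - ε) * φ s *
          ((1 / p) * deriv (deriv φ) s - deriv φ s)) = 0 := by
  obtain ⟨hε0, hε1⟩ := hε
  have hp0 : 0 < p := by linarith
  have hp1 : 0 < p - 1 := by linarith
  have he1 : 0 < 1 - ε := by linarith
  have hpe : 0 < 1 + p * ε := by positivity
  have hc0 : 0 < c := by rw [hc]; positivity
  have hd0 : 0 < d := by rw [hd]; positivity
  have hq : 1 + (p - 1) * ε - p * ε ^ 2 = (1 - ε) * (1 + p * ε) := by ring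
  have hDisc : 4 * a * c - b ^ 2 = (4 * (p - 1)) ^ 2 * ((1 - ε) * (1 + p * ε) / p) := by
    rw [ha, hb, hc]; field_simp; ring
  have hDisc0 : 0 < 4 * a * c - b ^ 2 := by rw [hDisc]; positivity
  have hDsq : Real.sqrt (4 * a * c - b ^ 2) ^ 2 = 4 * a * c - b ^ 2 := Real.sq_sqrt hDisc0.le
  have hD0 : 0 < Real.sqrt (4 * a * c - b ^ 2) := Real.sqrt_pos.mpr hDisc0
  set D := Real.sqrt (4 * a * c - b ^ 2) with hD
  rw [hq] at hMlt
  have hD' : D * Real.sqrt (p / ((1 - ε) * (1 + p * ε))) = 4 * (p - 1) := by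
    rw [hD, ← Real.sqrt_mul hDisc0.le, hDisc]
    rw [show (4 * (p - 1)) ^ 2 * ((1 - ε) * (1 + p * ε) / p) * (p / ((1 - ε) * (1 + p * ε)))
      = (4 * (p - 1)) ^ 2 by field_simp]
    exact Real.sqrt_sq (by positivity)
  have hbD : b / D = -(ε * Real.sqrt (p / ((1 - ε) * (1 + p * ε)))) := by
    rw [div_eq_iff hD0.ne', hb]
    linear_combination ε * hD'
  have hkC : D / (2 * d) * ((2 / Real.sqrt p) * Real.sqrt ((1 - ε) / (1 + p * ε))) = 1 := by
    have h1 : (D / (2 * d) * ((2 / Real.sqrt p) * Real.sqrt ((1 - ε) / (1 + p * ε)))) ^ 2 = 1 := by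
      rw [mul_pow, mul_pow, div_pow, div_pow, hDsq, Real.sq_sqrt hp0.le,
        Real.sq_sqrt (by positivity), hDisc, hd]
      field_simp
    have h0 : 0 ≤ D / (2 * d) * ((2 / Real.sqrt p) * Real.sqrt ((1 - ε) / (1 + p * ε))) := by
      positivity
    nlinarith
  have hk0 : 0 < D / (2 * d) := by positivity
  have hθlow : ∀ t, 0 ≤ t → -(Real.pi / 2) < θ t := by
    intro t ht
    have h1 := Real.neg_pi_div_two_lt_arctan (b / D)
    have h2 : 0 ≤ D / (2 * d) * t := by positivity
    rw [hθ]; linarith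
  have hθM : θ M < Real.pi / 2 := by
    rw [hθ, hbD, Real.arctan_neg]
    have h1 := mul_lt_mul_of_pos_left hMlt hk0
    rw [← mul_assoc, hkC] at h1
    linarith
  have hθmono : ∀ x y, x ≤ y → θ x ≤ θ y := by
    intro x y hxy
    rw [hθ, hθ]
    gcongr
  have hθd : ∀ t, HasDerivAt θ (D / (2 * d)) t := by
    intro t
    have h : HasDerivAt (fun s => D / (2 * d) * s + Real.arctan (b / D)) (D / (2 * d)) t := by
      simpa using ((hasDerivAt_id t).const_mul (D / (2 * d))).add_const (Real.arctan (b / D))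
    rwa [← funext hθ] at h
  have hθc : Continuous θ := continuous_iff_continuousAt.mpr fun t => (hθd t).continuousAt
  set U : Set ℝ := θ ⁻¹' Set.Ioo (-(Real.pi / 2)) (Real.pi / 2) with hU
  have hUo : IsOpen U := isOpen_Ioo.preimage hθc
  have hcos : ∀ t ∈ U, Real.cos (θ t) ≠ 0 := fun t ht => (Real.cos_pos_of_mem_Ioo ht).ne'
  have htd : ∀ t ∈ U, HasDerivAt (fun τ => Real.tan (θ τ))
      (1 / Real.cos (θ t) ^ 2 * (D / (2 * d))) t := fun t ht =>
    (Real.hasDerivAt_tan (hcos t ht)).comp t (hθd t)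
  have htc : ContinuousOn (fun τ => Real.tan (θ τ)) U := fun t ht =>
    (htd t ht).continuousAt.continuousWithinAt
  have h0U : (0 : ℝ) ∈ U :=
    ⟨hθlow 0 le_rfl, lt_of_le_of_lt (hθmono 0 M hM.le) hθM⟩
  have hUint : ∀ t ∈ U, Set.uIcc 0 t ⊆ U := by
    intro t ht x hx
    rcases Set.mem_uIcc.mp hx with h | h
    · exact ⟨lt_of_lt_of_le h0U.1 (hθmono _ _ h.1), lt_of_le_of_lt (hθmono _ _ h.2) ht.2⟩
    · exact ⟨lt_of_lt_of_le ht.1 (hθmono _ _ h.1), lt_of_le_of_lt (hθmono _ _ h.2) h0U.2⟩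
  let w : ℝ → ℝ := fun t => -(b / (2 * c)) + D / (2 * c) * Real.tan (θ t)
  have hzd : ∀ t ∈ U, HasDerivAt z (w t) t := by
    intro t ht
    have hI : HasDerivAt (fun u => ∫ τ in (0 : ℝ)..u, Real.tan (θ τ)) (Real.tan (θ t)) t :=
      intervalIntegral.integral_hasDerivAt_right
        ((htc.mono (hUint t ht)).intervalIntegrable)
        (htc.stronglyMeasurableAtFilter hUo t ht) (htd t ht).continuousAt
    have h := ((hasDerivAt_id t).const_mul (-(b / (2 * c)))).add (hI.const_mul (D / (2 * c)))
    rw [funext hz]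
    rw [mul_one] at h
    exact h
  have hφd : ∀ t ∈ U, HasDerivAt φ (φ t * w t) t := by
    intro t ht
    have h := (hzd t ht).exp
    rw [← hφ] at h
    rwa [← funext hφ] at h
  intro s hs
  have hsU : s ∈ U := ⟨hθlow s hs.1, lt_of_le_of_lt (hθmono s M hs.2) hθM⟩
  have hwd : HasDerivAt w (D / (2 * c) * (1 / Real.cos (θ s) ^ 2 * (D / (2 * d)))) s :=
    ((htd s hsU).const_mul (D / (2 * c))).const_add _
  have hev : deriv φ =ᶠ[nhds s] fun t => φ t * w t := by
    filter_upwards [hUo.mem_nhds hsU] with t ht using (hφd t ht).deriv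
  have hφ1 : deriv φ s = φ s * w s := (hφd s hsU).deriv
  have hφ2 : deriv (deriv φ) s = φ s * w s * w s +
      φ s * (D / (2 * c) * (1 / Real.cos (θ s) ^ 2 * (D / (2 * d)))) := by
    rw [hev.deriv_eq]
    exact ((hφd s hsU).mul hwd).deriv
  have hode : d * (D / (2 * c) * (1 / Real.cos (θ s) ^ 2 * (D / (2 * d)))) =
      a + b * w s + c * w s ^ 2 := by
    have h1 : 1 / Real.cos (θ s) ^ 2 = 1 + Real.tan (θ s) ^ 2 := by
      rw [← Real.inv_one_add_tan_sq (hcos s hsU)]; simp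
    rw [h1]
    simp only [w]
    generalize Real.tan (θ s) = T
    field_simp
    linear_combination hDsq
  rw [hφ1, hφ2]
  generalize D / (2 * c) * (1 / Real.cos (θ s) ^ 2 * (D / (2 * d))) = w' at hode ⊢
  generalize w s = W at hode ⊢
  generalize φ s = F
  have key : (p - 1) * (1 - ε) * F * ((1 / p) * (F * W * W + F * w') - F * W) =
      (((p - 1) * F - 2 * (F * W)) / 2) ^ 2 := by
    rw [ha, hb, hc, hd] at hode
    field_simp at hode ⊢
    linear_combination F ^ 2 * hode
  rw [key, Real.sqrt_sq_eq_abs, abs_div, abs_two]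
  ring
end

section
/- (Weight function lemma.) Under the stated hypotheses, the function φ(s) = exp(z(s)) is well defined for 0 ≤ s ≤ M (the argument of the tangent in the integrand stays strictly between −π/2 and π/2) and is twice differentiable there, and it satisfies simultaneously: φ′(s) ≥ 0, 1 ≤ φ(s) ≤ φ(M), (1/p)·φ″(s) − φ′(s) ≥ 0, and |(p−1)·φ(s) − 2·φ′(s)| − 2·√((p−1)(1−ε)·φ(s)·((1/p)·φ″(s) − φ′(s))) = 0, for all 0 ≤ s ≤ M. -/
theorem stmt10 (p ε : ℝ) (hp : 1 < p) (hε : ε ∈ Set.Ioo (0 : ℝ) 1)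
    (a b c d : ℝ)
    (ha : a = (p - 1) ^ 2) (hb : b = -4 * (p - 1) * ε)
    (hc : c = (4 / p) * (1 + (p - 1) * ε)) (hd : d = (4 / p) * (p - 1) * (1 - ε))
    (θ z φ : ℝ → ℝ)
    (hθ : ∀ s, θ s = (Real.sqrt (4 * a * c - b ^ 2) / (2 * d)) * s +
        Real.arctan (b / Real.sqrt (4 * a * c - b ^ 2)))
    (hz : ∀ s, z s = -(b / (2 * c)) * s +
        (Real.sqrt (4 * a * c - b ^ 2) / (2 * c)) * ∫ τ in (0 : ℝ)..s, Real.tan (θ τ))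
    (hφ : ∀ s, φ s = Real.exp (z s))
    (M : ℝ) (hM : 0 < M)
    (hMlt : M < (2 / Real.sqrt p) * Real.sqrt ((1 - ε) / (1 + p * ε)) *
        (Real.pi / 2 + Real.arctan (ε * Real.sqrt (p / (1 + (p - 1) * ε - p * ε ^ 2))))) :
    (∀ s ∈ Set.Icc 0 M, θ s ∈ Set.Ioo (-(Real.pi / 2)) (Real.pi / 2)) ∧
    (∀ s ∈ Set.Icc 0 M, DifferentiableAt ℝ φ s ∧ DifferentiableAt ℝ (deriv φ) s) ∧
    ∀ s ∈ Set.Icc 0 M,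
      0 ≤ deriv φ s ∧
      (1 ≤ φ s ∧ φ s ≤ φ M) ∧
      0 ≤ (1 / p) * deriv (deriv φ) s - deriv φ s ∧
      |(p - 1) * φ s - 2 * deriv φ s| -
        2 * Real.sqrt ((p - 1) * (1 - ε) * φ s *
          ((1 / p) * deriv (deriv φ) s - deriv φ s)) = 0 := by
  obtain ⟨hε0, hε1⟩ := hε
  have hp0 : 0 < p := by linarith
  have hp1 : 0 < p - 1 := by linarith
  have he1 : 0 < 1 - ε := by linarith
  have hpe : 0 < 1 + p * ε := by positivity
  have hQ : 1 + (p - 1) * ε - p * ε ^ 2 = (1 - ε) * (1 + p * ε) := by ring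
  have hc0 : 0 < c := by rw [hc]; positivity
  have hd0 : 0 < d := by rw [hd]; positivity
  have hDisc : 4 * a * c - b ^ 2 = (4 * (p - 1)) ^ 2 * ((1 - ε) * (1 + p * ε) / p) := by
    rw [ha, hb, hc]; field_simp; ring
  have hDpos : 0 < 4 * a * c - b ^ 2 := by rw [hDisc]; positivity
  have hD2 := Real.sq_sqrt hDpos.le
  have hD0 := Real.sqrt_pos.mpr hDpos
  have hDval : Real.sqrt (4 * a * c - b ^ 2)
      = 4 * (p - 1) * Real.sqrt ((1 - ε) * (1 + p * ε) / p) := by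
    rw [hDisc, Real.sqrt_mul (by positivity), Real.sqrt_sq (by positivity)]
  have hbD : b / Real.sqrt (4 * a * c - b ^ 2)
      = -(ε * Real.sqrt (p / (1 + (p - 1) * ε - p * ε ^ 2))) := by
    rw [hDval, hb, hQ, ← inv_div ((1 - ε) * (1 + p * ε)) p, Real.sqrt_inv]
    have : 0 < Real.sqrt ((1 - ε) * (1 + p * ε) / p) := Real.sqrt_pos.mpr (by positivity)
    field_simp
  have hk : (Real.sqrt (4 * a * c - b ^ 2) / (2 * d)) *
      ((2 / Real.sqrt p) * Real.sqrt ((1 - ε) / (1 + p * ε))) = 1 := by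
    rw [hDval, hd, Real.sqrt_div (by positivity), Real.sqrt_div (by positivity),
      Real.sqrt_mul (by positivity)]
    have h1 : 0 < Real.sqrt p := Real.sqrt_pos.mpr hp0
    have h2 : 0 < Real.sqrt (1 + p * ε) := Real.sqrt_pos.mpr hpe
    have h3 := Real.sq_sqrt hp0.le
    have h4 := Real.sq_sqrt he1.le
    field_simp
    rw [h3, h4]
    field_simp
    try norm_num
  generalize Real.sqrt (4 * a * c - b ^ 2) = D at *
  set k := D / (2 * d) with hkdef
  have hk0 : 0 < k := by positivity
  have hθ0 : θ 0 = Real.arctan (b / D) := by rw [hθ]; ring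
  have hmono : Monotone θ := by
    intro x y h
    rw [hθ, hθ]
    have := mul_le_mul_of_nonneg_left h hk0.le
    linarith
  have hθM : θ M < Real.pi / 2 := by
    rw [hθ, hbD, Real.arctan_neg]
    have := mul_lt_mul_of_pos_left hMlt hk0
    rw [← mul_assoc, hk, one_mul] at this
    linarith
  have hθ0' : -(Real.pi / 2) < θ 0 := by rw [hθ0]; exact Real.neg_pi_div_two_lt_arctan _
  have hmem : ∀ s ∈ Set.Icc 0 M, θ s ∈ Set.Ioo (-(Real.pi / 2)) (Real.pi / 2) := fun s hs =>
    ⟨hθ0'.trans_le (hmono hs.1), (hmono hs.2).trans_lt hθM⟩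
  have hθd : ∀ s, HasDerivAt θ k s := by
    intro s
    have : θ = fun s => k * s + Real.arctan (b / D) := funext hθ
    rw [this]
    simpa using ((hasDerivAt_id s).const_mul k).add_const (Real.arctan (b / D))
  have hθc : Continuous θ := continuous_iff_continuousAt.mpr fun s => (hθd s).continuousAt
  set U : Set ℝ := θ ⁻¹' Set.Ioo (-(Real.pi / 2)) (Real.pi / 2) with hU
  have hUo : IsOpen U := isOpen_Ioo.preimage hθc
  have hUc : U.OrdConnected := Set.ordConnected_Ioo.preimage_mono hmono
  have h0U : (0 : ℝ) ∈ U := hmem 0 ⟨le_rfl, hM.le⟩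
  have htd : ∀ s ∈ U, HasDerivAt (fun x => Real.tan (θ x)) ((1 + Real.tan (θ s) ^ 2) * k) s := by
    intro s hs
    have hcos : 0 < Real.cos (θ s) := Real.cos_pos_of_mem_Ioo hs
    have h := (Real.hasDerivAt_tan hcos.ne').comp s (hθd s)
    have e : 1 + Real.tan (θ s) ^ 2 = 1 / Real.cos (θ s) ^ 2 := by
      rw [Real.tan_eq_sin_div_cos]
      have := Real.sin_sq_add_cos_sq (θ s)
      field_simp
      linarith
    rw [e]
    exact h
  have htc : ContinuousOn (fun x => Real.tan (θ x)) U := fun s hs =>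
    (htd s hs).continuousAt.continuousWithinAt
  let w : ℝ → ℝ := fun s => -(b / (2 * c)) + D / (2 * c) * Real.tan (θ s)
  have hzd : ∀ s ∈ U, HasDerivAt z (w s) s := by
    intro s hs
    have hi := intervalIntegral.integral_hasDerivAt_right
      (htc.mono (hUc.uIcc_subset h0U hs)).intervalIntegrable
      (htc.stronglyMeasurableAtFilter hUo s hs) (htd s hs).continuousAt
    have : z = fun s => -(b / (2 * c)) * s + (D / (2 * c)) * ∫ τ in (0 : ℝ)..s, Real.tan (θ τ) :=
      funext hz
    rw [this]
    have h := ((hasDerivAt_id s).const_mul (-(b / (2 * c)))).add (hi.const_mul (D / (2 * c)))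
    rw [mul_one] at h
    exact h
  have hφd : ∀ s ∈ U, HasDerivAt φ (φ s * w s) s := by
    intro s hs
    have : φ = fun s => Real.exp (z s) := funext hφ
    rw [this]
    exact (hzd s hs).exp
  have hwd : ∀ s ∈ U, HasDerivAt w ((a + b * w s + c * w s ^ 2) / d) s := by
    intro s hs
    have h := ((htd s hs).const_mul (D / (2 * c))).const_add (-(b / (2 * c)))
    have e : (a + b * w s + c * w s ^ 2) / d
        = D / (2 * c) * ((1 + Real.tan (θ s) ^ 2) * k) := by
      simp only [w, hkdef]
      field_simp
      linear_combination (-1 : ℝ) * hD2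
    rw [e]
    exact h
  have hφdd : ∀ s ∈ U, HasDerivAt (deriv φ)
      (φ s * w s * w s + φ s * ((a + b * w s + c * w s ^ 2) / d)) s := by
    intro s hs
    refine ((hφd s hs).mul (hwd s hs)).congr_of_eventuallyEq ?_
    filter_upwards [hUo.mem_nhds hs] with x hx
    exact (hφd x hx).deriv
  have hφpos : ∀ s, 0 < φ s := fun s => by rw [hφ]; exact Real.exp_pos _
  have hw0 : ∀ s ∈ Set.Icc 0 M, 0 ≤ w s := by
    intro s hs
    have h1 : Real.tan (θ 0) ≤ Real.tan (θ s) :=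
      Real.strictMonoOn_tan.monotoneOn h0U (hmem s hs) (hmono hs.1)
    rw [hθ0, Real.tan_arctan] at h1
    have h2 := mul_le_mul_of_nonneg_left h1 (show 0 ≤ D / (2 * c) by positivity)
    have h3 : D / (2 * c) * (b / D) = b / (2 * c) := by field_simp
    simp only [w]
    linarith
  have hφm : MonotoneOn φ (Set.Icc 0 M) := by
    refine monotoneOn_of_deriv_nonneg (convex_Icc 0 M)
      (fun s hs => (hφd s (hmem s hs)).continuousAt.continuousWithinAt)
      (fun s hs => (hφd s (hmem s (interior_subset hs))).differentiableAt.differentiableWithinAt)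
      (fun s hs => ?_)
    have hs' := interior_subset hs
    rw [(hφd s (hmem s hs')).deriv]
    exact mul_nonneg (hφpos s).le (hw0 s hs')
  have hφ0 : φ 0 = 1 := by rw [hφ, hz]; simp
  refine ⟨hmem, fun s hs => ⟨(hφd s (hmem s hs)).differentiableAt,
    (hφdd s (hmem s hs)).differentiableAt⟩, fun s hs => ?_⟩
  have key : 4 * ((p - 1) * (1 - ε)) * ((1 / p) * deriv (deriv φ) s - deriv φ s)
      = φ s * (p - 1 - 2 * w s) ^ 2 := by
    rw [(hφd s (hmem s hs)).deriv, (hφdd s (hmem s hs)).deriv, ha, hb, hc, hd]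
    field_simp
    ring
  refine ⟨?_, ⟨?_, ?_⟩, ?_, ?_⟩
  · rw [(hφd s (hmem s hs)).deriv]
    exact mul_nonneg (hφpos s).le (hw0 s hs)
  · rw [← hφ0]
    exact hφm ⟨le_rfl, hM.le⟩ hs hs.1
  · exact hφm hs ⟨hM.le, le_rfl⟩ hs.2
  · have h1 : 0 < 4 * ((p - 1) * (1 - ε)) := by positivity
    have h2 : 0 ≤ φ s * (p - 1 - 2 * w s) ^ 2 := mul_nonneg (hφpos s).le (sq_nonneg _)
    rw [← key] at h2
    exact nonneg_of_mul_nonneg_right h2 h1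
  · have e : (p - 1) * (1 - ε) * φ s * ((1 / p) * deriv (deriv φ) s - deriv φ s)
        = (((p - 1) * φ s - 2 * deriv φ s) / 2) ^ 2 := by
      have h := (hφd s (hmem s hs)).deriv
      have : (p - 1) * (1 - ε) * φ s * ((1 / p) * deriv (deriv φ) s - deriv φ s)
        = φ s / 4 * (4 * ((p - 1) * (1 - ε)) * ((1 / p) * deriv (deriv φ) s - deriv φ s)) := by
        ring
      rw [this, key, h]
      ring
    rw [e, Real.sqrt_sq_eq_abs, abs_div, abs_of_pos (show (0 : ℝ) < 2 by norm_num)]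
    ring
end

section
/- Let n ≥ 2 be an integer and let M be a real number with 0 < M < √(2/n)·π. Then there exist real numbers ε ∈ (0,1) and p with p > n/2 and p > 1 such that M < (2/√p)·√((1−ε)/(1+pε))·(π/2 + arctan(ε·√(p/(1+(p−1)ε−pε²)))). -/
/-- Let `n ≥ 2` be an integer and `0 < M < √(2/n)·π`. Then there are `ε ∈ (0,1)` and
`p > n/2` with `p > 1` such that
`M < (2/√p)·√((1−ε)/(1+pε))·(π/2 + arctan(ε·√(p/(1+(p−1)ε−pε²))))`. -/
theorem stmt12 (n : ℕ) (hn : 2 ≤ n) (M : ℝ) (hM : 0 < M)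
    (hMlt : M < Real.sqrt (2 / n) * Real.pi) :
    ∃ ε ∈ Set.Ioo (0 : ℝ) 1, ∃ p : ℝ, (n / 2 : ℝ) < p ∧ 1 < p ∧
      M < (2 / Real.sqrt p) * Real.sqrt ((1 - ε) / (1 + p * ε)) *
        (Real.pi / 2 +
          Real.arctan (ε * Real.sqrt (p / (1 + (p - 1) * ε - p * ε ^ 2)))) := by
  have hn' : (2 : ℝ) ≤ n := by exact_mod_cast hn
  have hpos : (0 : ℝ) < n / 2 := by linarith
  let F : ℝ → ℝ := fun t =>
    (2 / Real.sqrt (n / 2 + t)) * Real.sqrt ((1 - t) / (1 + (n / 2 + t) * t)) *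
        (Real.pi / 2 +
          Real.arctan (t * Real.sqrt ((n / 2 + t) /
            (1 + ((n / 2 + t) - 1) * t - (n / 2 + t) * t ^ 2))))
  have h1 : Real.sqrt (n / 2 + 0) ≠ 0 := by
    rw [add_zero]; exact (Real.sqrt_pos.mpr hpos).ne'
  have hF : ContinuousAt F 0 := by
    have c1 : ContinuousAt (fun t : ℝ => 2 / Real.sqrt (n / 2 + t)) 0 :=
      ContinuousAt.div (by fun_prop) (by fun_prop) h1
    have c2 : ContinuousAt (fun t : ℝ => (1 - t) / (1 + (n / 2 + t) * t)) 0 :=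
      ContinuousAt.div (by fun_prop) (by fun_prop) (by norm_num)
    have c3 : ContinuousAt (fun t : ℝ => (n / 2 + t) /
            (1 + ((n / 2 + t) - 1) * t - (n / 2 + t) * t ^ 2)) 0 :=
      ContinuousAt.div (by fun_prop) (by fun_prop) (by norm_num)
    have c4 : ContinuousAt (fun t : ℝ => t * Real.sqrt ((n / 2 + t) /
            (1 + ((n / 2 + t) - 1) * t - (n / 2 + t) * t ^ 2))) 0 :=
      continuousAt_id.mul c3.sqrt
    exact (c1.mul c2.sqrt).mul
      (continuousAt_const.add (Real.continuous_arctan.continuousAt.comp c4))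
  have hF0 : F 0 = Real.sqrt (2 / n) * Real.pi := by
    have : Real.sqrt (2 / n) = (Real.sqrt (n / 2))⁻¹ := by
      rw [← Real.sqrt_inv, inv_div]
    simp only [F, this]
    simp only [add_zero, zero_mul, mul_zero, sub_zero, div_one, Real.sqrt_one,
      Real.arctan_zero, mul_one]
    generalize Real.sqrt (n / 2) = s
    ring
  have hev : ∀ᶠ t in nhds (0 : ℝ), M < F t :=
    hF.eventually (lt_mem_nhds (by rw [hF0]; exact hMlt))
  obtain ⟨δ, hδ, hb⟩ := Metric.eventually_nhds_iff.mp hev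
  have hm : 0 < min (δ / 2) (1 / 2) := by positivity
  have hm1 := min_le_left (δ / 2) (1 / 2)
  have hm2 := min_le_right (δ / 2) (1 / 2)
  refine ⟨min (δ / 2) (1 / 2), ⟨hm, by linarith⟩, n / 2 + min (δ / 2) (1 / 2),
    by linarith, by linarith, ?_⟩
  apply hb
  rw [Real.dist_eq, sub_zero, abs_of_pos hm]
  linarith
end

section
/- Let d ≥ 1 be an integer, let Ω ⊂ ℝᵈ be a nonempty bounded open set, and let f : closure(Ω) × [0,∞) → ℝ be continuous. Suppose there exist constants C > 0 and θ ∈ (0,1) such that for every t ≥ 1, all x, y ∈ closure(Ω) and all s₁, s₂ ∈ [t, t+1] one has |f(x,s₁) − f(y,s₂)| ≤ C·(‖x−y‖^θ + |s₁−s₂|^{θ/2}). Suppose further that for some constant N > 0 the integral ∫₀^∞ ∫_Ω (f(x,t) − N)² dx dt is finite. Then sup_{x ∈ closure(Ω)} |f(x,t) − N| → 0 as t → ∞. -/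
open MeasureTheory Filter

/-- Let `Ω ⊂ ℝᵈ` (`d ≥ 1`) be a nonempty bounded open set and let
`f : closure Ω × [0,∞) → ℝ` be continuous. If `f` satisfies a uniform parabolic Hölder
estimate `|f(x,s₁) − f(y,s₂)| ≤ C(‖x−y‖^θ + |s₁−s₂|^(θ/2))` on `closure Ω × [t,t+1]` for
every `t ≥ 1`, and `∫₀^∞ ∫_Ω (f(x,t) − N)² dx dt < ∞` for some `N > 0`, then
`sup_{x ∈ closure Ω} |f(x,t) − N| → 0` as `t → ∞`. -/
theorem stmt15 (d : ℕ) (hd : 1 ≤ d)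
    (Ω : Set (EuclideanSpace ℝ (Fin d)))
    (hΩopen : IsOpen Ω) (hΩne : Ω.Nonempty) (hΩbdd : Bornology.IsBounded Ω)
    (f : EuclideanSpace ℝ (Fin d) → ℝ → ℝ)
    (hf_cont : ContinuousOn (fun q : EuclideanSpace ℝ (Fin d) × ℝ => f q.1 q.2)
      (closure Ω ×ˢ Set.Ici (0 : ℝ)))
    (C θ : ℝ) (hC : 0 < C) (hθ : θ ∈ Set.Ioo (0 : ℝ) 1)
    (hf_holder : ∀ t : ℝ, 1 ≤ t → ∀ x ∈ closure Ω, ∀ y ∈ closure Ω,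
      ∀ s₁ ∈ Set.Icc t (t + 1), ∀ s₂ ∈ Set.Icc t (t + 1),
        |f x s₁ - f y s₂| ≤ C * (‖x - y‖ ^ θ + |s₁ - s₂| ^ (θ / 2)))
    (N : ℝ) (hN : 0 < N)
    (hf_int : ∫⁻ t in Set.Ioi (0 : ℝ), ∫⁻ x in Ω, ENNReal.ofReal ((f x t - N) ^ 2) < ⊤) :
    Tendsto (fun t : ℝ => ⨆ x : closure Ω, |f x t - N|) atTop (nhds 0) := by
  have hθ0 : 0 < θ := hθ.1
  -- choice of the modulus
  have hmod : ∀ ε : ℝ, 0 < ε → ∃ δ : ℝ, 0 < δ ∧ δ < 1 ∧ C * (δ ^ θ + δ ^ (θ / 2)) < ε := by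
    intro ε hε
    have hc : ContinuousAt (fun r : ℝ => C * (r ^ θ + r ^ (θ / 2))) 0 := by
      have h1 : ContinuousAt (fun r : ℝ => r ^ θ) 0 :=
        Real.continuousAt_rpow_const _ _ (Or.inr hθ0.le)
      have h2 : ContinuousAt (fun r : ℝ => r ^ (θ / 2)) 0 :=
        Real.continuousAt_rpow_const _ _ (Or.inr (by positivity))
      exact (h1.add h2).const_mul C
    obtain ⟨η, hη, h⟩ := Metric.continuousAt_iff.1 hc ε hε
    refine ⟨min (η / 2) (1 / 2), by positivity, lt_of_le_of_lt (min_le_right _ _) (by norm_num), ?_⟩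
    have hpos : 0 < min (η / 2) (1 / 2) := by positivity
    have hlt : min (η / 2) (1 / 2) < η := lt_of_le_of_lt (min_le_left _ _) (by linarith)
    have h3 := @h (min (η / 2) (1 / 2)) (by
      rw [Real.dist_eq, sub_zero, abs_of_pos hpos]; exact hlt)
    rw [Real.dist_eq, Real.zero_rpow hθ0.ne', Real.zero_rpow (by positivity)] at h3
    simp only [add_zero, mul_zero, sub_zero] at h3
    exact lt_of_le_of_lt (le_abs_self _) h3
  -- tails of the integral
  set g : ℝ → ENNReal := fun t => ∫⁻ x in Ω, ENNReal.ofReal ((f x t - N) ^ 2) with hg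
  have htail : Tendsto (fun t : ℝ => ∫⁻ s in Set.Ioi t, g s) atTop (nhds 0) := by
    have h := tendsto_measure_iInter_atTop (μ := volume.withDensity g)
      (s := fun t : ℝ => Set.Ioi t) (fun t => measurableSet_Ioi.nullMeasurableSet)
      (fun a b hab => Set.Ioi_subset_Ioi hab)
      ⟨0, by rw [withDensity_apply _ measurableSet_Ioi]; exact hf_int.ne⟩
    have he : (⋂ t : ℝ, Set.Ioi t) = ∅ := by
      ext y; simp only [Set.mem_iInter, Set.mem_Ioi, Set.mem_empty_iff_false, iff_false]
      intro h; exact lt_irrefl _ (h y)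
    rw [he, measure_empty] at h
    refine h.congr fun t => ?_
    rw [Function.comp_apply, withDensity_apply _ measurableSet_Ioi]
  -- pointwise convergence
  have hpt : ∀ ε : ℝ, 0 < ε → ∀ x ∈ closure Ω, ∀ᶠ t : ℝ in atTop, |f x t - N| < ε := by
    intro ε hε x hx
    obtain ⟨δ, hδ, hδ1, hδε⟩ := hmod (ε / 2) (by positivity)
    set U := Ω ∩ Metric.ball x δ with hU
    have hUo : IsOpen U := hΩopen.inter Metric.isOpen_ball
    have hUne : U.Nonempty := by
      obtain ⟨y, hy, hxy⟩ := Metric.mem_closure_iff.1 hx δ hδ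
      exact ⟨y, hy, by rwa [Metric.mem_ball, dist_comm]⟩
    have hUpos : 0 < volume U := hUo.measure_pos volume hUne
    set c : ENNReal := ENNReal.ofReal ((ε / 2) ^ 2) with hc
    have hcpos : 0 < c := ENNReal.ofReal_pos.2 (by positivity)
    have hpos : 0 < c * volume U * ENNReal.ofReal δ :=
      ENNReal.mul_pos (ENNReal.mul_pos hcpos.ne' hUpos.ne').ne' (ENNReal.ofReal_pos.2 hδ).ne'
    filter_upwards [htail.eventually_lt_const hpos, eventually_ge_atTop (1 : ℝ)] with t ht ht1
    by_contra hcon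
    push Not at hcon
    refine absurd ht (not_lt.2 ?_)
    have hlow : ∀ s ∈ Set.Ioo t (t + δ), c * volume U ≤ g s := by
      intro s hs
      calc c * volume U = ∫⁻ _ in U, c := by rw [setLIntegral_const]
        _ ≤ ∫⁻ y in U, ENNReal.ofReal ((f y s - N) ^ 2) := by
            refine setLIntegral_mono' hUo.measurableSet fun y hy => ?_
            apply ENNReal.ofReal_le_ofReal
            have hh := hf_holder t ht1 x hx y (subset_closure hy.1) t
              ⟨le_rfl, by linarith⟩ s ⟨hs.1.le, by linarith [hs.2]⟩
            have hxy : ‖x - y‖ ≤ δ := by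
              have := hy.2
              rw [Metric.mem_ball, dist_comm, dist_eq_norm] at this
              exact this.le
            have hts : |t - s| ≤ δ := by
              rw [abs_le]; constructor <;> linarith [hs.1, hs.2]
            have h1 : ‖x - y‖ ^ θ ≤ δ ^ θ :=
              Real.rpow_le_rpow (norm_nonneg _) hxy hθ0.le
            have h2 : |t - s| ^ (θ / 2) ≤ δ ^ (θ / 2) :=
              Real.rpow_le_rpow (abs_nonneg _) hts (by positivity)
            have h3 : |f x t - f y s| < ε / 2 :=
              lt_of_le_of_lt (hh.trans (mul_le_mul_of_nonneg_left (add_le_add h1 h2) hC.le)) hδε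
            have h4 : |f x t - N| ≤ |f x t - f y s| + |f y s - N| := abs_sub_le _ _ _
            rw [← sq_abs (f y s - N)]
            exact pow_le_pow_left₀ (by positivity) (by linarith) 2
        _ ≤ g s := lintegral_mono_set Set.inter_subset_left
    calc c * volume U * ENNReal.ofReal δ = ∫⁻ _ in Set.Ioo t (t + δ), c * volume U := by
          rw [setLIntegral_const, Real.volume_Ioo, add_sub_cancel_left]
      _ ≤ ∫⁻ s in Set.Ioo t (t + δ), g s := setLIntegral_mono' measurableSet_Ioo hlow
      _ ≤ ∫⁻ s in Set.Ioi t, g s := lintegral_mono_set Set.Ioo_subset_Ioi_self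
  -- conclusion by compactness
  have hK : IsCompact (closure Ω) := hΩbdd.isCompact_closure
  rw [Metric.tendsto_nhds]
  intro ε hε
  obtain ⟨δ, hδ, hδ1, hδε⟩ := hmod (ε / 4) (by positivity)
  obtain ⟨F, hFs, hFfin, hFc⟩ := hK.finite_cover_balls hδ
  have hall : ∀ᶠ t : ℝ in atTop, ∀ z ∈ F, |f z t - N| < ε / 4 :=
    (hFfin.eventually_all).2 fun z hz => hpt (ε / 4) (by positivity) z (hFs hz)
  filter_upwards [hall, eventually_ge_atTop (1 : ℝ)] with t ht ht1
  have hle : (⨆ x : closure Ω, |f x t - N|) ≤ ε / 2 := by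
    refine Real.iSup_le (fun x => ?_) (by positivity)
    obtain ⟨z, hz, hxz⟩ := Set.mem_iUnion₂.1 (hFc x.2)
    have hh := hf_holder t ht1 x x.2 z (hFs hz) t
      ⟨le_rfl, by linarith⟩ t ⟨le_rfl, by linarith⟩
    have hxy : ‖(x : EuclideanSpace ℝ (Fin d)) - z‖ ≤ δ := by
      rw [Metric.mem_ball, dist_eq_norm] at hxz
      exact hxz.le
    have h1 : ‖(x : EuclideanSpace ℝ (Fin d)) - z‖ ^ θ ≤ δ ^ θ :=
      Real.rpow_le_rpow (norm_nonneg _) hxy hθ0.le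
    have h2 : |t - t| ^ (θ / 2) ≤ δ ^ (θ / 2) :=
      Real.rpow_le_rpow (abs_nonneg _) (by simpa using hδ.le) (by positivity)
    have h3 : |f x t - f z t| < ε / 4 :=
      lt_of_le_of_lt (hh.trans (mul_le_mul_of_nonneg_left (add_le_add h1 h2) hC.le)) hδε
    have h4 : |f x t - N| ≤ |f x t - f z t| + |f z t - N| := abs_sub_le _ _ _
    linarith [ht z hz]
  have hge : 0 ≤ (⨆ x : closure Ω, |f x t - N|) := Real.iSup_nonneg fun x => abs_nonneg _
  rw [Real.dist_eq, sub_zero, abs_of_nonneg hge]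
  linarith
end
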